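/- arXiv:0907.0774 — 2 statements merged into one kernel-verified Lean document; each statement's English description precedes it below -/
import Mathlib

section
/- Let A be a finite-dimensional semisimple F-algebra and V a finite-dimensional A-module. If u ∈ V satisfies Ann_A(u)·V ⊄ A·u, then there exists u' ∈ V with dim(A·u') > dim(A·u). More precisely: choosing b ∈ Ann_A(u) and w ∈ V with b·w ∉ A·u, and a submodule W' complementary to A·u with w = a·u + w' (a ∈ A, w' ∈ W'), the element u' := u + w' satisfies dim(A·u') > dim(A·u). -/
theorem stmt11 (F A : Type*) [Field F] [Ring A] [Algebra F A]
    [FiniteDimensional F A] [IsSemisimpleRing A]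
    (V : Type*) [AddCommGroup V] [Module A V] [Module F V]
    [IsScalarTower F A V] [FiniteDimensional F V]
    (u : V) (b : A) (hb : b • u = 0) (w : V)
    (hbw : b • w ∉ Submodule.span A {u})
    (W' : Submodule A V)
    (hcompl : IsCompl (Submodule.span A {u}) W')
    (a : A) (w' : V) (hw' : w' ∈ W') (hw : w = a • u + w') :
    Module.finrank F ((Submodule.span A {u}).restrictScalars F) <
      Module.finrank F ((Submodule.span A {u + w'}).restrictScalars F) := by
  have key : ∀ v : V, Module.finrank F ((Submodule.span A {v}).restrictScalars F) +
      Module.finrank F (LinearMap.ker ((LinearMap.toSpanSingleton A V v).restrictScalars F)) =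
      Module.finrank F A := by
    intro v
    have h := LinearMap.finrank_range_add_finrank_ker
      ((LinearMap.toSpanSingleton A V v).restrictScalars F)
    have e : LinearMap.range ((LinearMap.toSpanSingleton A V v).restrictScalars F) =
        (Submodule.span A {v}).restrictScalars F := by
      ext x
      simp [Submodule.mem_span_singleton]
    rw [e] at h
    exact h
  have hlt : LinearMap.ker ((LinearMap.toSpanSingleton A V (u + w')).restrictScalars F) <
      LinearMap.ker ((LinearMap.toSpanSingleton A V u).restrictScalars F) := by
    rw [SetLike.lt_iff_le_and_exists]
    refine ⟨?_, b, ?_, ?_⟩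
    · intro x hx
      have hx' : x • u + x • w' = 0 := by
        rw [← smul_add]; simpa using hx
      have h1 : x • u ∈ Submodule.span A {u} :=
        Submodule.smul_mem _ _ (Submodule.mem_span_singleton_self u)
      have h2 : x • u ∈ W' := by
        rw [eq_neg_of_add_eq_zero_left hx']
        exact W'.neg_mem (W'.smul_mem _ hw')
      have h3 := Submodule.disjoint_def.mp hcompl.disjoint _ h1 h2
      simpa using h3
    · simpa using hb
    · intro hx
      have hx' : b • (u + w') = 0 := by simpa using hx
      rw [smul_add, hb, zero_add] at hx'
      apply hbw
      rw [hw, smul_add, hx', add_zero, smul_smul]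
      exact Submodule.smul_mem _ _ (Submodule.mem_span_singleton_self u)
  have h := Submodule.finrank_lt_finrank_of_lt hlt
  have h1 := key u
  have h2 := key (u + w')
  omega
end

section
/- Let A be a finite-dimensional semisimple F-algebra, V a finite-dimensional A-module, ℓ a positive integer, and u₁,…,u_ℓ ∈ V. For each i let Wᵢ be the submodule generated by {u₁,…,u_ℓ} \ {uᵢ}. Then the submodule A·{u₁,…,u_ℓ} has maximum dimension among all submodules of V generated by at most ℓ elements if and only if for every i, the cyclic submodule of V/Wᵢ generated by uᵢ + Wᵢ has maximum dimension among cyclic submodules of V/Wᵢ. -/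
namespace Stmt13Aux

/-- Rank-nullity for the restriction of `f` to a submodule. -/
theorem dimD {F A M N : Type*} [Field F] [Ring A] [Algebra F A]
    [AddCommGroup M] [Module A M] [Module F M] [IsScalarTower F A M] [FiniteDimensional F M]
    [AddCommGroup N] [Module A N] [Module F N] [IsScalarTower F A N]
    (f : M →ₗ[A] N) (S : Submodule A M) :
    Module.finrank F ((S.map f).restrictScalars F) +
      Module.finrank F ((S ⊓ LinearMap.ker f).restrictScalars F) =
      Module.finrank F (S.restrictScalars F) := by
  let g : (S.restrictScalars F) →ₗ[F] N := (f.restrictScalars F).domRestrict (S.restrictScalars F)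
  have h := LinearMap.finrank_range_add_finrank_ker g
  have h1 : LinearMap.range g = (S.map f).restrictScalars F := by
    ext x; simp [g, LinearMap.domRestrict_apply]
  have h2 : (LinearMap.ker g).map (S.restrictScalars F).subtype =
      (S ⊓ LinearMap.ker f).restrictScalars F := by
    ext x; simp [g, LinearMap.domRestrict_apply]; exact and_comm
  rw [← h, ← h1, ← h2, LinearEquiv.finrank_eq (Submodule.equivMapOfInjective
    (S.restrictScalars F).subtype (Subtype.val_injective) (LinearMap.ker g))]

theorem dim_mono {F A M : Type*} [Field F] [Ring A] [Algebra F A]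
    [AddCommGroup M] [Module A M] [Module F M] [IsScalarTower F A M] [FiniteDimensional F M]
    {S T : Submodule A M} (h : S ≤ T) :
    Module.finrank F (S.restrictScalars F) ≤ Module.finrank F (T.restrictScalars F) :=
  Submodule.finrank_mono (by exact h)

theorem dim_range {F A M N : Type*} [Field F] [Ring A] [Algebra F A]
    [AddCommGroup M] [Module A M] [Module F M] [IsScalarTower F A M] [FiniteDimensional F M]
    [AddCommGroup N] [Module A N] [Module F N] [IsScalarTower F A N]
    (f : M →ₗ[A] N) :
    Module.finrank F ((LinearMap.range f).restrictScalars F) +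
      Module.finrank F ((LinearMap.ker f).restrictScalars F) =
      Module.finrank F ((⊤ : Submodule A M).restrictScalars F) := by
  have := dimD (F := F) f ⊤
  rwa [top_inf_eq, Submodule.map_top] at this

theorem main {F A M N : Type*} [Field F] [Ring A] [Algebra F A]
    [AddCommGroup M] [Module A M] [Module F M] [IsScalarTower F A M] [FiniteDimensional F M]
    [AddCommGroup N] [Module A N] [Module F N] [IsScalarTower F A N] [FiniteDimensional F N]
    (θ φ : M →ₗ[A] N)
    (hK : ∀ f : LinearMap.ker θ →ₗ[A] (N ⧸ LinearMap.range θ), f = 0) :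
    Module.finrank F ((LinearMap.range φ).restrictScalars F) ≤
      Module.finrank F ((LinearMap.range θ).restrictScalars F) := by
  have : IsNoetherian A N := isNoetherian_of_tower F inferInstance
  let P : Set (Submodule A N) := {T | T ≤ LinearMap.range θ ∧
    ∀ f : T →ₗ[A] (N ⧸ LinearMap.range θ), f = 0}
  have hne : P.Nonempty := ⟨⊥, bot_le, fun f => by
    ext x; obtain ⟨x, hx⟩ := x
    have : (⟨x, hx⟩ : (⊥ : Submodule A N)) = 0 := Subsingleton.elim _ _
    rw [this, map_zero, map_zero]⟩
  obtain ⟨T, ⟨hTU, hT⟩, hmax⟩ := set_has_maximal_iff_noetherian.mpr this P hne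
  -- homs out of the preimage vanish
  have hpre : ∀ f : T.comap θ →ₗ[A] (N ⧸ LinearMap.range θ), f = 0 := by
    intro f
    have hk : LinearMap.ker θ ≤ T.comap θ := fun x hx => by
      have : θ x = 0 := hx
      simp [this]
    have h0 := hK (f ∘ₗ Submodule.inclusion hk)
    let r : T.comap θ →ₗ[A] T := θ.restrict (fun x hx => hx)
    have hr : Function.Surjective r := by
      rintro ⟨t, ht⟩
      obtain ⟨m, rfl⟩ := hTU ht
      exact ⟨⟨m, ht⟩, rfl⟩
    have hker : LinearMap.ker r ≤ LinearMap.ker f := by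
      rintro ⟨x, hx⟩ hxr
      have hx0 : θ x = 0 := congrArg Subtype.val (show r ⟨x, hx⟩ = 0 from hxr)
      exact LinearMap.congr_fun h0 ⟨x, hx0⟩
    let e := r.quotKerEquivOfSurjective hr
    have h1 := hT ((LinearMap.ker r).liftQ f hker ∘ₗ e.symm.toLinearMap)
    ext x
    have h2 := LinearMap.congr_fun h1 (r x)
    have h3 : e.symm (r x) = Submodule.Quotient.mk x := by
      rw [LinearEquiv.symm_apply_eq]; rfl
    simpa [h3] using h2
  have himU : (T.comap θ).map φ ≤ LinearMap.range θ := by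
    rintro _ ⟨x, hx, rfl⟩
    have := LinearMap.congr_fun (hpre ((LinearMap.range θ).mkQ ∘ₗ φ ∘ₗ (T.comap θ).subtype)) ⟨x, hx⟩
    exact (Submodule.Quotient.mk_eq_zero _).mp this
  have hle : (T.comap θ).map φ ≤ T := by
    by_contra hcon
    refine hmax (T ⊔ (T.comap θ).map φ) ⟨sup_le hTU himU, fun f => ?_⟩ ?_
    · have h1 := hT (f ∘ₗ Submodule.inclusion le_sup_left)
      have h2 := hpre (f ∘ₗ Submodule.inclusion (le_sup_right : (T.comap θ).map φ ≤ T ⊔ _) ∘ₗ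
        φ.restrict (fun x hx => Submodule.mem_map_of_mem hx))
      ext ⟨x, hx⟩
      obtain ⟨a, ha, b, ⟨c, hc, rfl⟩, rfl⟩ := Submodule.mem_sup.mp hx
      have e1 := LinearMap.congr_fun h1 ⟨a, ha⟩
      have e2 := LinearMap.congr_fun h2 ⟨c, hc⟩
      have : (⟨a + φ c, hx⟩ : ↥(T ⊔ (T.comap θ).map φ)) =
        Submodule.inclusion le_sup_left ⟨a, ha⟩ +
        Submodule.inclusion (le_sup_right : (T.comap θ).map φ ≤ T ⊔ _)
          (φ.restrict (fun x hx => Submodule.mem_map_of_mem hx) ⟨c, hc⟩) := rfl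
      rw [this, map_add]
      simp only [LinearMap.comp_apply] at e1 e2
      rw [e1, e2]; simp
    · exact left_lt_sup.mpr hcon
  have d1 := dim_range (F := F) φ
  have d2 := dim_range (F := F) θ
  have d3 := dimD (F := F) φ (T.comap φ)
  have d4 := dimD (F := F) θ (T.comap θ)
  rw [inf_eq_right.mpr (LinearMap.ker_le_comap _)] at d3 d4
  have m1 : (T.comap θ).map θ = T := by
    rw [Submodule.map_comap_eq, inf_eq_right.mpr hTU]
  rw [m1] at d4
  have m2 := dim_mono (F := F) (Submodule.map_comap_le φ T)
  have m3 := dim_mono (F := F) (Submodule.map_le_iff_le_comap.mp hle)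
  omega

theorem dim_sup {F A V : Type*} [Field F] [Ring A] [Algebra F A]
    [AddCommGroup V] [Module A V] [Module F V] [IsScalarTower F A V] [FiniteDimensional F V]
    (W : Submodule A V) (v : V) :
    Module.finrank F ((Submodule.span A {(Submodule.Quotient.mk v : V ⧸ W)}).restrictScalars F) +
      Module.finrank F (W.restrictScalars F) =
      Module.finrank F ((Submodule.span A {v} ⊔ W).restrictScalars F) := by
  have h := dimD (F := F) W.mkQ (Submodule.span A {v} ⊔ W)
  rw [Submodule.ker_mkQ, inf_eq_right.mpr le_sup_right, Submodule.map_sup, Submodule.map_span,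
    Submodule.mkQ_map_self, sup_bot_eq, Set.image_singleton] at h
  exact h

theorem span_split {A V : Type*} [Ring A] [AddCommGroup V] [Module A V] {n : ℕ}
    (u : Fin n → V) (i : Fin n) :
    Submodule.span A (Set.range u) =
      Submodule.span A {u i} ⊔ Submodule.span A (u '' ({i}ᶜ : Set (Fin n))) := by
  rw [← Submodule.span_union, ← Set.image_singleton, ← Set.image_union, Set.union_compl_self,
    Set.image_univ]

/-- Local maximality at `i` forces homs from the annihilator of `u i` mod `W` to vanish. -/
theorem local_hom {F A V : Type*} [Field F] [Ring A] [Algebra F A]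
    [FiniteDimensional F A] [IsSemisimpleRing A]
    [AddCommGroup V] [Module A V] [Module F V] [IsScalarTower F A V] [FiniteDimensional F V]
    (W U : Submodule A V) (w : V) (hW : W ≤ U) (hw : w ∈ U)
    (hmax : ∀ x : V ⧸ W, Module.finrank F ((Submodule.span A {x}).restrictScalars F) ≤
      Module.finrank F ((Submodule.span A
        {(Submodule.Quotient.mk w : V ⧸ W)}).restrictScalars F))
    (g : A →ₗ[A] V ⧸ U) (a : A) (ha : a • w ∈ W) : g a = 0 := by
  obtain ⟨s, hs⟩ := IsSemisimpleModule.lifting_property U.mkQ U.mkQ_surjective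
    (LinearMap.id : (V ⧸ U) →ₗ[A] V ⧸ U)
  have hs' : ∀ y, U.mkQ (s y) = y := fun y => LinearMap.congr_fun hs y
  let k : V → (A →ₗ[A] V ⧸ W) := fun v => LinearMap.toSpanSingleton A _ (W.mkQ v)
  have hk : ∀ v b, b ∈ LinearMap.ker (k v) ↔ b • v ∈ W := fun v b => by
    simp only [k, LinearMap.mem_ker, LinearMap.toSpanSingleton_apply, ← map_smul]
    exact Submodule.Quotient.mk_eq_zero _
  have key : ∀ b, b ∈ LinearMap.ker (k (w + s (g 1))) → b • w ∈ W ∧ g b = 0 := by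
    intro b hb
    rw [hk] at hb
    have e : b • s (g 1) = s (g b) := by
      rw [← map_smul, ← map_smul, smul_eq_mul, mul_one]
    rw [smul_add, e] at hb
    have h1 : s (g b) ∈ U := (Submodule.add_mem_iff_right _ (U.smul_mem b hw)).mp (hW hb)
    have h2 : g b = 0 := by
      rw [← hs' (g b)]; exact (Submodule.Quotient.mk_eq_zero _).mpr h1
    rw [h2, map_zero, add_zero] at hb
    exact ⟨hb, h2⟩
  have hle : LinearMap.ker (k (w + s (g 1))) ≤ LinearMap.ker (k w) := fun b hb =>
    (hk _ _).mpr (key b hb).1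
  have d1 := dim_range (F := F) (k w)
  have d2 := dim_range (F := F) (k (w + s (g 1)))
  have hm := hmax (W.mkQ (w + s (g 1)))
  have r : ∀ v, LinearMap.range (k v) = Submodule.span A {W.mkQ v} := fun v =>
    LinearMap.range_toSpanSingleton _
  rw [r] at d1 d2
  change _ ≤ Module.finrank F ((Submodule.span A {W.mkQ w}).restrictScalars F) at hm
  have heq : (LinearMap.ker (k (w + s (g 1)))).restrictScalars F =
      (LinearMap.ker (k w)).restrictScalars F :=
    Submodule.eq_of_le_of_finrank_le (by exact hle) (by omega)
  have : a ∈ (LinearMap.ker (k w)).restrictScalars F := (hk w a).mpr ha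
  rw [← heq] at this
  exact (key a this).2

end Stmt13Aux

theorem stmt13 (F A : Type*) [Field F] [Ring A] [Algebra F A]
    [FiniteDimensional F A] [IsSemisimpleRing A]
    (V : Type*) [AddCommGroup V] [Module A V] [Module F V]
    [IsScalarTower F A V] [FiniteDimensional F V]
    (ℓ : ℕ) (hℓ : 1 ≤ ℓ) (u : Fin ℓ → V) :
    (∀ u' : Fin ℓ → V,
        Module.finrank F ((Submodule.span A (Set.range u')).restrictScalars F) ≤
          Module.finrank F ((Submodule.span A (Set.range u)).restrictScalars F)) ↔
    (∀ i : Fin ℓ,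
        ∀ x : V ⧸ Submodule.span A (u '' ({i}ᶜ : Set (Fin ℓ))),
          Module.finrank F ((Submodule.span A {x}).restrictScalars F) ≤
            Module.finrank F ((Submodule.span A
              {(Submodule.Quotient.mk (u i) :
                V ⧸ Submodule.span A (u '' ({i}ᶜ : Set (Fin ℓ))))}).restrictScalars F)) := by
  constructor
  · intro h i x
    obtain ⟨v, rfl⟩ := Submodule.Quotient.mk_surjective _ x
    have h1 := h (Function.update u i v)
    have him : Function.update u i v '' ({i}ᶜ : Set (Fin ℓ)) = u '' ({i}ᶜ : Set (Fin ℓ)) :=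
      Set.image_congr fun j hj => Function.update_of_ne hj _ _
    rw [Stmt13Aux.span_split (A := A) u i, Stmt13Aux.span_split (A := A) (Function.update u i v) i, him,
      Function.update_self, ← Stmt13Aux.dim_sup, ← Stmt13Aux.dim_sup] at h1
    exact Nat.le_of_add_le_add_right h1
  · intro h u'
    rw [← Fintype.range_linearCombination A u, ← Fintype.range_linearCombination A u']
    apply Stmt13Aux.main
    intro f
    obtain ⟨g, hg⟩ := IsSemisimpleModule.extension_property
      (LinearMap.ker (Fintype.linearCombination A u)).subtype Subtype.val_injective f
    ext ⟨c, hc⟩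
    rw [← hg]
    change g c = 0
    rw [← Finset.univ_sum_single c, map_sum]
    refine Finset.sum_eq_zero fun i _ => ?_
    have hU := Fintype.range_linearCombination A u
    refine Stmt13Aux.local_hom (F := F) (Submodule.span A (u '' ({i}ᶜ : Set (Fin ℓ)))) _ (u i) ?_ ?_ (h i)
      (g ∘ₗ LinearMap.single A (fun _ => A) i) (c i) ?_
    · rw [hU]; exact Submodule.span_mono (Set.image_subset_range _ _)
    · rw [hU]; exact Submodule.subset_span ⟨i, rfl⟩
    · have h0 : ∑ j, c j • u j = 0 := hc
      rw [← Finset.add_sum_erase _ _ (Finset.mem_univ i)] at h0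
      rw [eq_neg_of_add_eq_zero_left h0]
      refine Submodule.neg_mem _ (Submodule.sum_mem _ fun j hj => Submodule.smul_mem _ _ ?_)
      exact Submodule.subset_span ⟨j, Finset.ne_of_mem_erase hj, rfl⟩
end
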